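/- arXiv:2205.04543 — 3 statements merged into one kernel-verified Lean document; each statement's English description precedes it below -/
import Mathlib

section
/- Let X be a compact Hausdorff topological space and (E, ‖·‖_E) a normed space. Let A be a non-empty subset of C(X,E) such that each section A(x), x ∈ X, is precompact. Then A satisfies the condition (DS) if and only if A − A satisfies the condition (B). -/
open Pointwise

/-- Condition (B). -/
def CondB {X E : Type*} [TopologicalSpace X] [NormedAddCommGroup E]
    (S : Set (BoundedContinuousFunction X E)) : Prop :=
  ∀ ε : ℝ, 0 < ε → ∃ (N : ℕ) (U : Fin N → Set X),
    (⋃ i, U i) = Set.univ ∧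
    ∀ i : Fin N, ∀ x ∈ U i, ∀ y ∈ U i, ∀ f ∈ S, |‖f x‖ - ‖f y‖| ≤ ε

/-- Condition (DS). -/
def CondDS {X E : Type*} [TopologicalSpace X] [NormedAddCommGroup E]
    (S : Set (BoundedContinuousFunction X E)) : Prop :=
  ∀ ε : ℝ, 0 < ε → ∃ (N : ℕ) (U : Fin N → Set X),
    (∀ i, (U i).Nonempty) ∧ (⋃ i, U i) = Set.univ ∧
    ∀ i : Fin N, ∀ x ∈ U i, ∀ y ∈ U i, ∀ f ∈ S, ‖f x - f y‖ ≤ ε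

/-- A finite product of totally bounded sets is totally bounded. -/
theorem totallyBounded_univ_pi {ι : Type*} [Fintype ι] {β : ι → Type*}
    [∀ i, PseudoMetricSpace (β i)] {s : ∀ i, Set (β i)} (hs : ∀ i, TotallyBounded (s i)) :
    TotallyBounded (Set.univ.pi s) := by
  refine Metric.totallyBounded_iff.2 fun ε hε => ?_
  choose t ht hst using fun i => Metric.totallyBounded_iff.1 (hs i) ε hε
  refine ⟨Set.univ.pi t, Set.Finite.pi ht, fun f hf => ?_⟩
  have hf' : ∀ i, ∃ y ∈ t i, dist (f i) y < ε := fun i => by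
    simpa using hst i (hf i (Set.mem_univ i))
  choose g hg hfg using hf'
  exact Set.mem_biUnion (fun i _ => hg i) ((dist_pi_lt_iff hε).2 hfg)

/-- A map with totally bounded range is approximated by its values on a finite set. -/
theorem exists_finite_forall_dist_lt {α β : Type*} [PseudoMetricSpace β] {F : α → β}
    (hF : TotallyBounded (Set.range F)) {ε : ℝ} (hε : 0 < ε) :
    ∃ t : Set α, t.Finite ∧ ∀ a, ∃ b ∈ t, dist (F a) (F b) < ε := by
  rw [← Set.image_univ] at hF
  obtain ⟨t, -, ht, hcover⟩ := Set.exists_subset_image_finite_and.1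
    (hF.exists_subset (Metric.dist_mem_uniformity hε))
  refine ⟨t, ht, fun a => ?_⟩
  simpa using hcover (Set.mem_image_of_mem F (Set.mem_univ a))

/-- Condition (B) lets one pick a representative from each non-empty member of the cover. -/
theorem CondB.exists_finite {X E : Type*} [TopologicalSpace X] [NormedAddCommGroup E]
    {S : Set (BoundedContinuousFunction X E)} (hS : CondB S) {ε : ℝ} (hε : 0 < ε) :
    ∃ t : Set X, t.Finite ∧ ∀ x, ∃ y ∈ t, ∀ f ∈ S, |‖f x‖ - ‖f y‖| ≤ ε := by
  obtain ⟨N, U, hU, h⟩ := hS ε hε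
  have hmem : ∀ x, ∃ i, x ∈ U i := fun x => by
    simpa using hU.symm.subset (Set.mem_univ x)
  let p : {i // (U i).Nonempty} → X := fun i => i.2.choose
  refine ⟨Set.range p, Set.finite_range p, fun x => ?_⟩
  obtain ⟨i, hi⟩ := hmem x
  exact ⟨p ⟨i, x, hi⟩, Set.mem_range_self _,
    h i x hi _ (Set.Nonempty.some_mem (⟨x, hi⟩ : (U i).Nonempty))⟩

/-- If `A - A` satisfies (B) and the sections of `A` are precompact, then `A` has finite
uniform nets. -/
theorem exists_finite_net_of_condB_sub {X E : Type*} [TopologicalSpace X] [NormedAddCommGroup E]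
    {A : Set (BoundedContinuousFunction X E)}
    (hsec : ∀ x : X, TotallyBounded ((fun f : BoundedContinuousFunction X E => f x) '' A))
    (hB : CondB (A - A)) {ε : ℝ} (hε : 0 < ε) :
    ∃ t : Set A, t.Finite ∧ ∀ f : A, ∃ g ∈ t, ∀ x, ‖f.1 x - g.1 x‖ ≤ ε := by
  obtain ⟨T, hT, hTapprox⟩ := hB.exists_finite (half_pos hε)
  have : Fintype T := hT.fintype
  have hrange : TotallyBounded (Set.range fun (f : A) (y : T) => f.1 y) := by
    refine (totallyBounded_univ_pi fun y : T => hsec y).subset ?_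
    rintro _ ⟨f, rfl⟩ y -
    exact ⟨f.1, f.2, rfl⟩
  obtain ⟨t, ht, happrox⟩ := exists_finite_forall_dist_lt hrange (half_pos hε)
  refine ⟨t, ht, fun f => ?_⟩
  obtain ⟨g, hg, hfg⟩ := happrox f
  refine ⟨g, hg, fun x => ?_⟩
  obtain ⟨y, hy, hxy⟩ := hTapprox x
  have h₁ := hxy _ (Set.sub_mem_sub f.2 g.2)
  have h₂ := (dist_pi_lt_iff (half_pos hε)).1 hfg ⟨y, hy⟩
  rw [dist_eq_norm] at h₂
  simp only [BoundedContinuousFunction.coe_sub, Pi.sub_apply] at h₁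
  linarith [(abs_le.1 h₁).2]

/-- Condition (DS) for `A` implies condition (B) for `A - A`. -/
theorem CondDS.condB_sub {X E : Type*} [TopologicalSpace X] [NormedAddCommGroup E]
    {A : Set (BoundedContinuousFunction X E)} (hA : CondDS A) : CondB (A - A) := by
  intro ε hε
  obtain ⟨N, U, -, hU, h⟩ := hA (ε / 2) (half_pos hε)
  refine ⟨N, U, hU, ?_⟩
  rintro i x hx y hy _ ⟨f, hf, g, hg, rfl⟩
  have hf' := h i x hx y hy f hf
  have hg' := h i x hx y hy g hg
  calc |‖f x - g x‖ - ‖f y - g y‖| ≤ ‖(f x - g x) - (f y - g y)‖ := abs_norm_sub_norm_le _ _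
    _ = ‖(f x - f y) - (g x - g y)‖ := by rw [sub_sub_sub_comm]
    _ ≤ ‖f x - f y‖ + ‖g x - g y‖ := norm_sub_le _ _
    _ ≤ ε := by linarith

/-- On a compact space, a set with finite uniform nets satisfies (DS). -/
theorem condDS_of_finite_nets {X E : Type*} [TopologicalSpace X] [CompactSpace X]
    [NormedAddCommGroup E] {A : Set (BoundedContinuousFunction X E)}
    (hA : ∀ ε : ℝ, 0 < ε → ∃ t : Set A, t.Finite ∧
      ∀ f : A, ∃ g ∈ t, ∀ x, ‖f.1 x - g.1 x‖ ≤ ε) : CondDS A := by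
  intro ε hε
  have hε4 : 0 < ε / 4 := by positivity
  obtain ⟨t, ht, hnet⟩ := hA (ε / 4) hε4
  have : Fintype t := ht.fintype
  have hcont : Continuous fun (x : X) (g : t) => g.1.1 x :=
    continuous_pi fun g => g.1.1.continuous
  obtain ⟨T, hT, happrox⟩ := exists_finite_forall_dist_lt
    (isCompact_range hcont).totallyBounded hε4
  have : Finite T := hT
  obtain ⟨N, ⟨e⟩⟩ := Finite.exists_equiv_fin T
  let U : Fin N → Set X := fun i =>
    {x | ∀ g : t, dist (g.1.1 x) (g.1.1 (e.symm i)) ≤ ε / 4}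
  refine ⟨N, U, fun i => ⟨e.symm i, fun g => by simpa using hε4.le⟩, ?_, ?_⟩
  · refine Set.eq_univ_of_forall fun x => Set.mem_iUnion.2 ?_
    obtain ⟨y, hy, hxy⟩ := happrox x
    refine ⟨e ⟨y, hy⟩, fun g => ?_⟩
    simpa using ((dist_pi_lt_iff hε4).1 hxy g).le
  · intro i x hx y hy f hf
    obtain ⟨g, hg, hfg⟩ := hnet ⟨f, hf⟩
    have hx' := hx ⟨g, hg⟩
    have hy' := hy ⟨g, hg⟩
    have hfx := hfg x
    have hfy := hfg y
    rw [← dist_eq_norm] at hfx hfy ⊢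
    have h₁ := dist_triangle4 (f x) (g.1 x) (g.1 y) (f y)
    have h₂ := dist_triangle_right (g.1 x) (g.1 y) (g.1 (e.symm i))
    rw [dist_comm (g.1 y) (f y)] at h₁
    linarith

/-- Let `X` be a compact Hausdorff space, `E` a normed space and `A` a non-empty subset
of `C(X,E)` all of whose sections `A(x)` are precompact.  Then `A` satisfies (DS) iff
`A - A` satisfies (B). -/
theorem stmt_7 {X E : Type*} [TopologicalSpace X] [CompactSpace X] [T2Space X]
    [NormedAddCommGroup E] [NormedSpace ℝ E]
    (A : Set (BoundedContinuousFunction X E)) (hA : A.Nonempty)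
    (hsec : ∀ x : X, TotallyBounded ((fun f : BoundedContinuousFunction X E => f x) '' A)) :
    CondDS A ↔ CondB (A - A) := by
  exact ⟨CondDS.condB_sub, fun hB =>
    condDS_of_finite_nets fun _ hε => exists_finite_net_of_condB_sub hsec hB hε⟩
end

section
/- Let n ∈ ℕ, let 𝕂 be ℝ or ℂ, and let X be an arbitrary topological space. A non-empty subset A of C(X, 𝕂^n) is precompact if and only if A satisfies the condition (DS) and for every x ∈ X the section A(x) is precompact. -/
open Pointwise

open Bornology in
/-- A jointly bounded finite family of maps into a proper space satisfies a uniform version of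
(DS): the domain splits into finitely many pieces on which all maps oscillate by less than `ε`. -/
lemma exists_fin_cover_forall_dist_lt {X ι E : Type*} [Fintype ι] [PseudoMetricSpace E]
    [ProperSpace E] (φ : X → ι → E) (hφ : IsBounded (Set.range φ)) {ε : ℝ} (hε : 0 < ε) :
    ∃ (N : ℕ) (U : Fin N → Set X), (∀ i, (U i).Nonempty) ∧ (⋃ i, U i) = Set.univ ∧
      ∀ i, ∀ x ∈ U i, ∀ y ∈ U i, ∀ j, dist (φ x j) (φ y j) < ε := by
  have htb : TotallyBounded (Set.range φ) :=
    hφ.isCompact_closure.totallyBounded.subset subset_closure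
  obtain ⟨t, hts, htfin, hcov⟩ := Metric.finite_approx_of_totallyBounded htb (ε / 2) (half_pos hε)
  obtain ⟨N, e, -, he⟩ := htfin.fin_param
  refine ⟨N, fun i => φ ⁻¹' Metric.ball (e i) (ε / 2), fun i => ?_, ?_, fun i x hx y hy j => ?_⟩
  · obtain ⟨x, hx⟩ := hts (he ▸ Set.mem_range_self i)
    exact ⟨x, by simpa [hx] using half_pos hε⟩
  · refine Set.eq_univ_of_forall fun x => ?_
    obtain ⟨y, hy, hxy⟩ := Set.mem_iUnion₂.1 (hcov (Set.mem_range_self x))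
    obtain ⟨i, rfl⟩ := he.symm ▸ hy
    exact Set.mem_iUnion.2 ⟨i, hxy⟩
  · calc dist (φ x j) (φ y j) ≤ dist (φ x) (φ y) := dist_le_pi_dist _ _ _
      _ ≤ dist (φ x) (e i) + dist (φ y) (e i) := dist_triangle_right _ _ _
      _ < ε / 2 + ε / 2 := add_lt_add hx hy
      _ = ε := add_halves ε

lemma TotallyBounded.condDS {X E : Type*} [TopologicalSpace X] [NormedAddCommGroup E]
    [ProperSpace E] {A : Set (BoundedContinuousFunction X E)} (hA : TotallyBounded A) :
    CondDS A := by
  intro ε hε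
  obtain ⟨t, htfin, hcov⟩ := Metric.totallyBounded_iff.1 hA (ε / 3) (by positivity)
  have := htfin.fintype
  have hbdd : Bornology.IsBounded (Set.range fun (x : X) (g : t) => g.1 x) := by
    rw [← Bornology.forall_isBounded_image_eval_iff]
    intro g
    refine g.1.isBounded_range.subset ?_
    rintro _ ⟨_, ⟨x, rfl⟩, rfl⟩
    exact Set.mem_range_self x
  obtain ⟨N, U, hne, hU, hosc⟩ :=
    exists_fin_cover_forall_dist_lt _ hbdd (show 0 < ε / 3 by positivity)
  refine ⟨N, U, hne, hU, fun i x hx y hy f hf => ?_⟩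
  obtain ⟨g, hg, hfg⟩ := Set.mem_iUnion₂.1 (hcov hf)
  rw [Metric.mem_ball] at hfg
  have hgxy : dist (g x) (g y) < ε / 3 := hosc i x hx y hy ⟨g, hg⟩
  have hx' := f.dist_coe_le_dist (g := g) x
  have hy' := f.dist_coe_le_dist (g := g) y
  rw [dist_comm (f y)] at hy'
  rw [← dist_eq_norm]
  linarith [dist_triangle4 (f x) (g x) (g y) (f y)]

lemma CondDS.totallyBounded {X E : Type*} [TopologicalSpace X] [NormedAddCommGroup E]
    [ProperSpace E] {A : Set (BoundedContinuousFunction X E)} (hA : CondDS A)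
    (hsec : ∀ x, Bornology.IsBounded ((fun f : BoundedContinuousFunction X E => f x) '' A)) :
    TotallyBounded A := by
  refine Metric.totallyBounded_iff.2 fun ε hε => ?_
  obtain ⟨N, U, hne, hU, hosc⟩ := hA (ε / 4) (by positivity)
  choose p hp using hne
  let φ : BoundedContinuousFunction X E → Fin N → E := fun f i => f (p i)
  have hbdd : Bornology.IsBounded (φ '' A) := by
    rw [← Bornology.forall_isBounded_image_eval_iff]
    intro i
    rw [Set.image_image]
    exact hsec (p i)
  have htb : TotallyBounded (φ '' A) :=
    hbdd.isCompact_closure.totallyBounded.subset subset_closure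
  obtain ⟨t, hts, htfin, hcov⟩ :=
    Metric.finite_approx_of_totallyBounded htb (ε / 4) (by positivity)
  refine ⟨Function.invFunOn φ A '' t, htfin.image _, fun f hf => ?_⟩
  obtain ⟨c, hc, hfc⟩ := Set.mem_iUnion₂.1 (hcov (Set.mem_image_of_mem φ hf))
  refine Set.mem_iUnion₂.2 ⟨_, Set.mem_image_of_mem _ hc, ?_⟩
  have hgA : Function.invFunOn φ A c ∈ A := Function.invFunOn_mem (hts hc)
  have hgc : φ (Function.invFunOn φ A c) = c := Function.invFunOn_eq (hts hc)
  generalize Function.invFunOn φ A c = g at hgA hgc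
  rw [Metric.mem_ball, ← hgc] at hfc
  refine lt_of_le_of_lt ((BoundedContinuousFunction.dist_le (C := 3 * ε / 4) (by positivity)).2
    fun x => ?_) (show 3 * ε / 4 < ε by linarith)
  obtain ⟨i, hi⟩ := Set.mem_iUnion.1 (hU.symm ▸ Set.mem_univ x)
  have hf' := hosc i x hi (p i) (hp i) f hf
  have hg' := hosc i (p i) (hp i) x hi g hgA
  have hfg : dist (f (p i)) (g (p i)) ≤ dist (φ f) (φ g) := dist_le_pi_dist (φ f) (φ g) i
  rw [← dist_eq_norm] at hf' hg'
  linarith [dist_triangle4 (f x) (f (p i)) (g (p i)) (g x)]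

/-- Let `𝕂` be `ℝ` or `ℂ`, `n ∈ ℕ` and `X` an arbitrary topological space.  A non-empty
subset `A` of `C(X,𝕂ⁿ)` (bounded continuous maps with the supremum norm) is precompact
iff `A` satisfies (DS) and every section `A(x)` is precompact. -/
theorem stmt_8 (n : ℕ) (𝕂 : Type*) [RCLike 𝕂] {X : Type*} [TopologicalSpace X]
    (A : Set (BoundedContinuousFunction X (EuclideanSpace 𝕂 (Fin n)))) (hA : A.Nonempty) :
    TotallyBounded A ↔
      CondDS A ∧
        ∀ x : X,
          TotallyBounded
            ((fun f : BoundedContinuousFunction X (EuclideanSpace 𝕂 (Fin n)) => f x) '' A) := by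
  have : ProperSpace (EuclideanSpace 𝕂 (Fin n)) := FiniteDimensional.proper_rclike 𝕂 _
  refine ⟨fun h => ⟨h.condDS, fun x => h.image ?_⟩, fun h =>
    h.1.totallyBounded fun x => (h.2 x).isBounded⟩
  exact (BoundedContinuousFunction.lipschitz_eval_const x).uniformContinuous
end

section
/- Let φ be a comparison function, (X, d) a compact metric space, and (E, ‖·‖_E) a normed space. Let A be a non-empty subset of Lip_φ(X,E) such that the sections A(x) := {f(x) : f ∈ A} are precompact for every x ∈ X. Then the following are equivalent: (i) A − A satisfies the condition (L) with sets U_1, …, U_N that are open in X̃; (ii) A − A satisfies the condition (Λ). -/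
open Pointwise Metric

/-- A comparison function. -/
structure IsCompFun (φ : ℝ → ℝ) : Prop where
  nonneg : ∀ t : ℝ, 0 ≤ t → 0 ≤ φ t
  map_zero : φ 0 = 0
  right_cont : ContinuousWithinAt φ (Set.Ici 0) 0
  concave : ConcaveOn ℝ (Set.Ici 0) φ
  ne_zero : ∃ t : ℝ, 0 ≤ t ∧ φ t ≠ 0

/-- Membership in `Lip_φ(X,E)`. -/
def MemLip {X E : Type*} [MetricSpace X] [NormedAddCommGroup E]
    (φ : ℝ → ℝ) (f : X → E) : Prop :=
  BddAbove {r : ℝ | ∃ x y : X, x ≠ y ∧ r = ‖f x - f y‖ / φ (dist x y)}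

/-- Condition (L) with open sets: the sets of the finite cover of
`X̃ = (X×X) \ Δ` are required to be open (equivalently, open in `X̃`, since `X̃` is open
in `X × X`). -/
def CondLOpen {X E : Type*} [MetricSpace X] [NormedAddCommGroup E]
    (φ : ℝ → ℝ) (S : Set (X → E)) : Prop :=
  ∀ ε : ℝ, 0 < ε → ∃ (N : ℕ) (U : Fin N → Set (X × X)),
    (∀ i, U i ⊆ {p : X × X | p.1 ≠ p.2} ∧ IsOpen (U i)) ∧
    {p : X × X | p.1 ≠ p.2} ⊆ ⋃ i, U i ∧
    ∀ i : Fin N, ∀ p ∈ U i, ∀ q ∈ U i, ∀ f ∈ S,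
      |‖f p.1 - f p.2‖ / φ (dist p.1 p.2) - ‖f q.1 - f q.2‖ / φ (dist q.1 q.2)| ≤ ε

/-- Condition (Λ): a localized version of (L), where the (open) sets `U_i` cover a
neighbourhood of the diagonal and lie within distance `1/n` of it, and on each `U_i`
the oscillation of the quotients `‖f x - f y‖/φ(d(x,y))` is at most `ε`. -/
def CondLam {X E : Type*} [MetricSpace X] [NormedAddCommGroup E]
    (φ : ℝ → ℝ) (S : Set (X → E)) : Prop :=
  ∀ ε : ℝ, 0 < ε → ∀ n : ℕ, 0 < n →
    ∃ δ : ℝ, 0 < δ ∧ ∃ (N : ℕ) (U : Fin N → Set (X × X)),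
      (∀ i, U i ⊆ {p : X × X | p.1 ≠ p.2} ∧ IsOpen (U i)) ∧
      ((⋃ x : X, ball x δ ×ˢ ball x δ) ∩ {p : X × X | p.1 ≠ p.2} ⊆ ⋃ i, U i) ∧
      ((⋃ i, U i) ⊆
        (⋃ x : X, ball x (1 / (n : ℝ)) ×ˢ ball x (1 / (n : ℝ))) ∩
          {p : X × X | p.1 ≠ p.2}) ∧
      ∀ f ∈ S, ∀ i : Fin N,
        sSup {r : ℝ | ∃ p ∈ U i, r = ‖f (Prod.fst p) - f p.2‖ / φ (dist p.1 p.2)} -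
          sInf {r : ℝ | ∃ p ∈ U i, r = ‖f (Prod.fst p) - f p.2‖ / φ (dist p.1 p.2)} ≤ ε

open Filter Topology

namespace IsCompFun

variable {φ : ℝ → ℝ}

lemma pos (hφ : IsCompFun φ) {t : ℝ} (ht : 0 < t) : 0 < φ t := by
  obtain ⟨s, hs, hs'⟩ := hφ.ne_zero
  have hφs : 0 < φ s := lt_of_le_of_ne (hφ.nonneg s hs) hs'.symm
  have hs_pos : 0 < s := lt_of_le_of_ne hs fun h ↦ hs' (h ▸ hφ.map_zero)
  have hst : 0 < s + t := by positivity
  rcases le_total t s with h | h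
  · have hc := hφ.concave.2 (Set.mem_Ici.2 hs) (Set.mem_Ici.2 le_rfl)
      (div_nonneg ht.le hs) (sub_nonneg.2 ((div_le_one hs_pos).2 h)) (by ring)
    simp only [smul_eq_mul, hφ.map_zero, mul_zero, add_zero, div_mul_cancel₀ t hs_pos.ne'] at hc
    exact lt_of_lt_of_le (by positivity) hc
  · have hc := hφ.concave.2 (Set.mem_Ici.2 hs) (Set.mem_Ici.2 hst.le)
      (div_nonneg hs ht.le)
      (sub_nonneg.2 ((div_le_one ht).2 h)) (by ring)
    have heq : s / t * s + (1 - s / t) * (s + t) = t := by field_simp; ring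
    simp only [smul_eq_mul, heq] at hc
    have h2 : 0 ≤ (1 - s / t) * φ (s + t) :=
      mul_nonneg (sub_nonneg.2 ((div_le_one ht).2 h)) (hφ.nonneg _ hst.le)
    have h1 : 0 < s / t * φ s := by positivity
    linarith

lemma continuousAt (hφ : IsCompFun φ) {t : ℝ} (ht : 0 < t) : ContinuousAt φ t :=
  ((hφ.concave.subset Set.Ioi_subset_Ici_self (convex_Ioi 0)).continuousOn isOpen_Ioi).continuousAt
    (Ioi_mem_nhds ht)

lemma tendsto_dist {α X : Type*} [PseudoMetricSpace X] (hφ : IsCompFun φ) {l : Filter α}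
    {u : α → X} {x : X} (hu : Tendsto u l (𝓝 x)) :
    Tendsto (fun a ↦ φ (dist x (u a))) l (𝓝 0) := by
  have h : Tendsto (fun a ↦ dist x (u a)) l (𝓝[Set.Ici 0] 0) :=
    tendsto_nhdsWithin_iff.2
      ⟨by simpa using (tendsto_const_nhds (x := x)).dist hu, Eventually.of_forall fun _ ↦ dist_nonneg⟩
  have h0 := hφ.right_cont.tendsto.comp h
  rwa [hφ.map_zero] at h0

end IsCompFun

section

variable {X E : Type*} [MetricSpace X] [NormedAddCommGroup E] {φ : ℝ → ℝ}

/-- The difference quotient of `f` with respect to `φ`. -/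
noncomputable def phiQuotient (φ : ℝ → ℝ) (f : X → E) (p : X × X) : ℝ :=
  ‖f p.1 - f p.2‖ / φ (dist p.1 p.2)

lemma phiQuotient_nonneg (hφ : IsCompFun φ) (f : X → E) (p : X × X) : 0 ≤ phiQuotient φ f p :=
  div_nonneg (norm_nonneg _) (hφ.nonneg _ dist_nonneg)

lemma MemLip.sub (hφ : IsCompFun φ) {f g : X → E} (hf : MemLip φ f) (hg : MemLip φ g) :
    MemLip φ (f - g) := by
  obtain ⟨a, ha⟩ := hf
  obtain ⟨b, hb⟩ := hg
  refine ⟨a + b, ?_⟩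
  rintro _ ⟨x, y, hxy, rfl⟩
  refine le_trans ?_ (add_le_add (ha ⟨x, y, hxy, rfl⟩) (hb ⟨x, y, hxy, rfl⟩))
  rw [← add_div]
  refine div_le_div_of_nonneg_right ?_ (hφ.nonneg _ dist_nonneg)
  rw [Pi.sub_apply, Pi.sub_apply, sub_sub_sub_comm]
  exact norm_sub_le _ _

lemma abs_phiQuotient_sub_le (hφ : IsCompFun φ) {f : X → E} (hf : MemLip φ f) {U : Set (X × X)}
    (hU : U ⊆ {p : X × X | p.1 ≠ p.2}) {ε : ℝ}
    (h : sSup {r : ℝ | ∃ p ∈ U, r = phiQuotient φ f p} -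
      sInf {r : ℝ | ∃ p ∈ U, r = phiQuotient φ f p} ≤ ε) {p q : X × X} (hp : p ∈ U) (hq : q ∈ U) :
    |phiQuotient φ f p - phiQuotient φ f q| ≤ ε := by
  have hab : BddAbove {r : ℝ | ∃ p ∈ U, r = phiQuotient φ f p} := by
    refine hf.mono ?_
    rintro _ ⟨p, hp, rfl⟩
    exact ⟨p.1, p.2, hU hp, rfl⟩
  have hbe : BddBelow {r : ℝ | ∃ p ∈ U, r = phiQuotient φ f p} := by
    refine ⟨0, ?_⟩
    rintro _ ⟨p, -, rfl⟩
    exact phiQuotient_nonneg hφ f p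
  have h1 := le_csSup hab ⟨p, hp, rfl⟩
  have h2 := le_csSup hab ⟨q, hq, rfl⟩
  have h3 := csInf_le hbe ⟨p, hp, rfl⟩
  have h4 := csInf_le hbe ⟨q, hq, rfl⟩
  rw [abs_le]
  constructor <;> linarith

lemma sSup_sub_sInf_phiQuotient_le {f : X → E} {U : Set (X × X)} {ε : ℝ} (hε : 0 ≤ ε)
    (h : ∀ p ∈ U, ∀ q ∈ U, |phiQuotient φ f p - phiQuotient φ f q| ≤ ε) :
    sSup {r : ℝ | ∃ p ∈ U, r = phiQuotient φ f p} -
      sInf {r : ℝ | ∃ p ∈ U, r = phiQuotient φ f p} ≤ ε := by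
  rcases U.eq_empty_or_nonempty with rfl | ⟨p₀, hp₀⟩
  · simpa using hε
  have hne : {r : ℝ | ∃ p ∈ U, r = phiQuotient φ f p}.Nonempty := ⟨_, p₀, hp₀, rfl⟩
  rw [sub_le_iff_le_add]
  refine csSup_le hne ?_
  rintro _ ⟨p, hp, rfl⟩
  rw [← sub_le_iff_le_add']
  refine le_csInf hne ?_
  rintro _ ⟨q, hq, rfl⟩
  linarith [(abs_le.1 (h p hp q hq)).2]

lemma condLOpen_of_finite_cover {S : Set (X → E)}
    (h : ∀ ε : ℝ, 0 < ε → ∃ (ι : Type*) (_ : Finite ι) (U : ι → Set (X × X)),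
      (∀ i, U i ⊆ {p : X × X | p.1 ≠ p.2} ∧ IsOpen (U i)) ∧
      {p : X × X | p.1 ≠ p.2} ⊆ ⋃ i, U i ∧
      ∀ i, ∀ p ∈ U i, ∀ q ∈ U i, ∀ f ∈ S, |phiQuotient φ f p - phiQuotient φ f q| ≤ ε) :
    CondLOpen φ S := by
  intro ε hε
  obtain ⟨ι, _, U, h1, h2, h3⟩ := h ε hε
  obtain ⟨N, ⟨e⟩⟩ := Finite.exists_equiv_fin ι
  refine ⟨N, U ∘ e.symm, fun i ↦ h1 _, ?_, fun i ↦ h3 _⟩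
  exact h2.trans (e.symm.surjective.iUnion_comp U).ge

lemma CondLOpen.condLam {S : Set (X → E)} (h : CondLOpen φ S) : CondLam φ S := by
  intro ε hε n hn
  obtain ⟨N, U, hU, hcov, hosc⟩ := h ε hε
  set W : Set (X × X) := ⋃ x : X, ball x (1 / (n : ℝ)) ×ˢ ball x (1 / (n : ℝ))
  have hWo : IsOpen W := isOpen_iUnion fun x ↦ isOpen_ball.prod isOpen_ball
  refine ⟨1 / n, by positivity, N, fun i ↦ U i ∩ W,
    fun i ↦ ⟨Set.inter_subset_left.trans (hU i).1, (hU i).2.inter hWo⟩, ?_, ?_, ?_⟩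
  · rintro p ⟨hpW, hp⟩
    rw [← Set.iUnion_inter]
    exact ⟨hcov hp, hpW⟩
  · exact Set.iUnion_subset fun i p hp ↦ ⟨hp.2, (hU i).1 hp.1⟩
  · exact fun f hf i ↦ sSup_sub_sInf_phiQuotient_le hε.le
      fun p hp q hq ↦ hosc i p hp.1 q hq.1 f hf

lemma exists_norm_le_of_totallyBounded_sections {X E : Type*} [NormedAddCommGroup E] {A : Set (X → E)}
    (hsec : ∀ x : X, TotallyBounded ((fun f : X → E ↦ f x) '' A)) (x : X) :
    ∃ M : ℝ, ∀ h ∈ A - A, ‖h x‖ ≤ M := by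
  obtain ⟨M, hM⟩ := (hsec x).isBounded.exists_norm_le
  refine ⟨M + M, ?_⟩
  rintro _ ⟨f, hf, g, hg, rfl⟩
  exact (norm_sub_le _ _).trans
    (add_le_add (hM _ (Set.mem_image_of_mem _ hf)) (hM _ (Set.mem_image_of_mem _ hg)))

lemma CondLam.exists_norm_sub_le (hφ : IsCompFun φ) {S : Set (X → E)} (hS : ∀ f ∈ S, MemLip φ f)
    (hbdd : ∀ x : X, ∃ M : ℝ, ∀ f ∈ S, ‖f x‖ ≤ M) (h : CondLam φ S) :
    ∃ δ > 0, ∃ C : ℝ, ∀ f ∈ S, ∀ x y : X, dist x y < δ → ‖f x - f y‖ ≤ C * φ (dist x y) := by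
  obtain ⟨δ, hδ, N, U, hU, hcov, -, hosc⟩ := h 1 one_pos 1 one_pos
  have key : ∀ i, ∃ C : ℝ, ∀ f ∈ S, ∀ p ∈ U i, phiQuotient φ f p ≤ C := by
    intro i
    rcases (U i).eq_empty_or_nonempty with h | ⟨q, hq⟩
    · exact ⟨0, by simp [h]⟩
    obtain ⟨a, ha⟩ := hbdd q.1
    obtain ⟨b, hb⟩ := hbdd q.2
    refine ⟨(a + b) / φ (dist q.1 q.2) + 1, fun f hf p hp ↦ ?_⟩
    have h1 := (abs_le.1 (abs_phiQuotient_sub_le hφ (hS f hf) (hU i).1 (hosc f hf i) hp hq)).2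
    have h2 : phiQuotient φ f q ≤ (a + b) / φ (dist q.1 q.2) :=
      div_le_div_of_nonneg_right ((norm_sub_le _ _).trans (add_le_add (ha f hf) (hb f hf)))
        (hφ.nonneg _ dist_nonneg)
    linarith
  choose C hC using key
  obtain ⟨D, hD⟩ := (Set.finite_range C).bddAbove
  refine ⟨δ, hδ, D, fun f hf x y hxy ↦ ?_⟩
  rcases eq_or_ne x y with rfl | hne
  · simp [hφ.map_zero]
  have hmem : ((x, y) : X × X) ∈ ⋃ i, U i :=
    hcov ⟨Set.mem_iUnion.2 ⟨x, mem_ball_self hδ, mem_ball'.2 hxy⟩, hne⟩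
  obtain ⟨i, hi⟩ := Set.mem_iUnion.1 hmem
  exact (div_le_iff₀ (hφ.pos (dist_pos.2 hne))).1
    ((hC i f hf _ hi).trans (hD (Set.mem_range_self i)))

lemma eventually_abs_phiQuotient_sub_lt (hφ : IsCompFun φ) {S : Set (X → E)}
    (hbdd : ∀ x : X, ∃ M : ℝ, ∀ f ∈ S, ‖f x‖ ≤ M) {δ : ℝ} (hδ : 0 < δ) {C : ℝ}
    (hC : ∀ f ∈ S, ∀ x y : X, dist x y < δ → ‖f x - f y‖ ≤ C * φ (dist x y))
    {p : X × X} (hp : p.1 ≠ p.2) {ε : ℝ} (hε : 0 < ε) :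
    ∀ᶠ q in 𝓝 p, ∀ f ∈ S, |phiQuotient φ f p - phiQuotient φ f q| < ε := by
  obtain ⟨a, ha⟩ := hbdd p.1
  obtain ⟨b, hb⟩ := hbdd p.2
  have hpos : 0 < φ (dist p.1 p.2) := hφ.pos (dist_pos.2 hp)
  have hfst : Tendsto (fun q : X × X ↦ q.1) (𝓝 p) (𝓝 p.1) := continuous_fst.tendsto p
  have hsnd : Tendsto (fun q : X × X ↦ q.2) (𝓝 p) (𝓝 p.2) := continuous_snd.tendsto p
  have hinv : Tendsto (fun q : X × X ↦ (φ (dist q.1 q.2))⁻¹) (𝓝 p)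
      (𝓝 (φ (dist p.1 p.2))⁻¹) :=
    (((hφ.continuousAt (dist_pos.2 hp)).tendsto.comp (hfst.dist hsnd))).inv₀ hpos.ne'
  have hlim : Tendsto (fun q : X × X ↦
      (a + b) * |(φ (dist p.1 p.2))⁻¹ - (φ (dist q.1 q.2))⁻¹| +
        (C * φ (dist p.1 q.1) + C * φ (dist p.2 q.2)) * (φ (dist q.1 q.2))⁻¹) (𝓝 p) (𝓝 0) := by
    simpa using ((hinv.const_sub (φ (dist p.1 p.2))⁻¹).abs.const_mul (a + b)).add
      ((((hφ.tendsto_dist hfst).const_mul C).add ((hφ.tendsto_dist hsnd).const_mul C)).mul hinv)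
  filter_upwards [hlim.eventually (gt_mem_nhds hε), hfst (ball_mem_nhds p.1 hδ),
    hsnd (ball_mem_nhds p.2 hδ)] with q hq hq1 hq2 f hf
  refine lt_of_le_of_lt ?_ hq
  have h1 := hC f hf _ _ (mem_ball'.1 hq1)
  have h2 := hC f hf _ _ (mem_ball'.1 hq2)
  have h3 : ‖f p.1 - f p.2‖ ≤ a + b := (norm_sub_le _ _).trans (add_le_add (ha f hf) (hb f hf))
  have h4 : |‖f p.1 - f p.2‖ - ‖f q.1 - f q.2‖| ≤
      C * φ (dist p.1 q.1) + C * φ (dist p.2 q.2) := by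
    refine (abs_norm_sub_norm_le _ _).trans ?_
    rw [sub_sub_sub_comm]
    exact (norm_sub_le _ _).trans (add_le_add h1 h2)
  have h5 : 0 ≤ (φ (dist q.1 q.2))⁻¹ := inv_nonneg.2 (hφ.nonneg _ dist_nonneg)
  have heq : phiQuotient φ f p - phiQuotient φ f q =
      ‖f p.1 - f p.2‖ * ((φ (dist p.1 p.2))⁻¹ - (φ (dist q.1 q.2))⁻¹) +
        (‖f p.1 - f p.2‖ - ‖f q.1 - f q.2‖) * (φ (dist q.1 q.2))⁻¹ := by
    simp only [phiQuotient, div_eq_mul_inv]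
    ring
  rw [heq]
  refine (abs_add_le _ _).trans (add_le_add ?_ ?_)
  · rw [abs_mul, abs_norm]
    exact mul_le_mul_of_nonneg_right h3 (abs_nonneg _)
  · rw [abs_mul, abs_of_nonneg h5]
    exact mul_le_mul_of_nonneg_right h4 h5

lemma CondLam.condLOpen [CompactSpace X] (hφ : IsCompFun φ) {S : Set (X → E)}
    (hS : ∀ f ∈ S, MemLip φ f) (hbdd : ∀ x : X, ∃ M : ℝ, ∀ f ∈ S, ‖f x‖ ≤ M)
    (h : CondLam φ S) : CondLOpen φ S := by
  obtain ⟨δ₀, hδ₀, C, hC⟩ := h.exists_norm_sub_le hφ hS hbdd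
  refine condLOpen_of_finite_cover fun ε hε ↦ ?_
  obtain ⟨δ, hδ, N, U, hU, hcov, -, hosc⟩ := h ε hε 1 one_pos
  have hoff : IsOpen {p : X × X | p.1 ≠ p.2} := isOpen_ne_fun continuous_fst continuous_snd
  have hnhds : ∀ p : X × X, p.1 ≠ p.2 → ∃ V : Set (X × X), V ⊆ {p : X × X | p.1 ≠ p.2} ∧
      IsOpen V ∧ p ∈ V ∧
      ∀ q ∈ V, ∀ r ∈ V, ∀ f ∈ S, |phiQuotient φ f q - phiQuotient φ f r| ≤ ε := by
    intro p hp
    obtain ⟨V, hV, hVo, hpV⟩ := _root_.eventually_nhds_iff.1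
      ((eventually_abs_phiQuotient_sub_lt hφ hbdd hδ₀ hC hp (half_pos hε)).and
        (hoff.eventually_mem hp))
    refine ⟨V, fun q hq ↦ (hV q hq).2, hVo, hpV, fun q hq r hr f hf ↦ ?_⟩
    have h1 := abs_lt.1 ((hV q hq).1 f hf)
    have h2 := abs_lt.1 ((hV r hr).1 f hf)
    rw [abs_le]
    constructor <;> linarith [h1.1, h1.2, h2.1, h2.2]
  set W : Set (X × X) := ⋃ x : X, ball x δ ×ˢ ball x δ
  have hWo : IsOpen W := isOpen_iUnion fun x ↦ isOpen_ball.prod isOpen_ball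
  have hWoff : ∀ p ∈ Wᶜ, p.1 ≠ p.2 := by
    intro p hp heq
    exact hp (Set.mem_iUnion.2 ⟨p.1, mem_ball_self hδ, heq ▸ mem_ball_self hδ⟩)
  choose V hVoff hVo hpV hVosc using fun p : (Wᶜ : Set (X × X)) ↦ hnhds p (hWoff p p.2)
  obtain ⟨t, ht⟩ := hWo.isClosed_compl.isCompact.elim_finite_subcover V hVo
    fun p hp ↦ Set.mem_iUnion.2 ⟨⟨p, hp⟩, hpV _⟩
  refine ⟨Fin N ⊕ t, inferInstance, Sum.elim U fun p ↦ V p, ?_, ?_, ?_⟩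
  · rintro (i | p)
    · exact hU i
    · exact ⟨hVoff p, hVo p⟩
  · intro p hp
    by_cases hpW : p ∈ W
    · obtain ⟨i, hi⟩ := Set.mem_iUnion.1 (hcov ⟨hpW, hp⟩)
      exact Set.mem_iUnion.2 ⟨Sum.inl i, hi⟩
    · obtain ⟨q, hq, hpq⟩ := Set.mem_iUnion₂.1 (ht hpW)
      exact Set.mem_iUnion.2 ⟨Sum.inr ⟨q, hq⟩, hpq⟩
  · rintro (i | p)
    · exact fun p hp q hq f hf ↦ abs_phiQuotient_sub_le hφ (hS f hf) (hU i).1 (hosc f hf i) hp hq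
    · exact hVosc p

end

/-- For a compact metric space `X` and `A ⊆ Lip_φ(X,E)` with precompact sections,
`A - A` satisfies (L) with open sets iff `A - A` satisfies (Λ). -/
theorem stmt_17 {X E : Type*} [MetricSpace X] [CompactSpace X]
    [NormedAddCommGroup E] [NormedSpace ℝ E]
    (φ : ℝ → ℝ) (hφ : IsCompFun φ)
    (A : Set (X → E)) (hA : A.Nonempty) (hAL : ∀ f ∈ A, MemLip φ f)
    (hsec : ∀ x : X, TotallyBounded ((fun f : X → E => f x) '' A)) :
    CondLOpen φ (A - A) ↔ CondLam φ (A - A) := by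
  refine ⟨CondLOpen.condLam, CondLam.condLOpen hφ ?_
    (exists_norm_le_of_totallyBounded_sections hsec)⟩
  rintro _ ⟨f, hf, g, hg, rfl⟩
  exact (hAL f hf).sub hφ (hAL g hg)
end
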